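/- The monodromy M = R₂₁R, where R₂₁ = τ(R) with τ the flip of tensor factors, lies in the image of ι ⊗ ι : U ⊗ U → D ⊗ D, where ι : U → D is the embedding E ↦ e, F ↦ φ, K ↦ k². -/

import Mathlib

open scoped TensorProduct
open Finset

noncomputable section

namespace LogHennings

/-- `q = exp(iπ/p)`. -/
def qq (p : ℕ) : ℂ := Complex.exp ((Real.pi : ℂ) * Complex.I / (p : ℂ))

/-- `q^{1/2} = exp(iπ/(2p))`. -/
def qh (p : ℕ) : ℂ := Complex.exp ((Real.pi : ℂ) * Complex.I / (2 * (p : ℂ)))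

/-- quantum integer `[m] = (q^m - q^{-m})/(q - q⁻¹)`. -/
def qnum (p m : ℕ) : ℂ := ((qq p) ^ m - (qq p)⁻¹ ^ m) / (qq p - (qq p)⁻¹)

/-- quantum factorial `[m]! = [m][m-1]⋯[1]`. -/
def qfac (p : ℕ) : ℕ → ℂ
  | 0 => 1
  | m + 1 => qnum p (m + 1) * qfac p m

/-- Generators of the restricted quantum group `U`. -/
inductive UGen | E | F | K | Kinv

abbrev FU := FreeAlgebra ℂ UGen

def fE : FU := FreeAlgebra.ι ℂ UGen.E
def fF : FU := FreeAlgebra.ι ℂ UGen.F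
def fK : FU := FreeAlgebra.ι ℂ UGen.K
def fKinv : FU := FreeAlgebra.ι ℂ UGen.Kinv

/-- Defining relations of the restricted quantum group `U`. -/
inductive URel (p : ℕ) : FU → FU → Prop
  | Epow : URel p (fE ^ p) 0
  | Fpow : URel p (fF ^ p) 0
  | Kpow : URel p (fK ^ (2 * p)) 1
  | KKinv : URel p (fK * fKinv) 1
  | KinvK : URel p (fKinv * fK) 1
  | KE : URel p (fK * fE * fKinv) ((qq p) ^ 2 • fE)
  | KF : URel p (fK * fF * fKinv) (((qq p) ^ 2)⁻¹ • fF)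
  | EF : URel p (fE * fF - fF * fE) ((qq p - (qq p)⁻¹)⁻¹ • (fK - fKinv))

/-- The restricted quantum group `U = \bar U_q(sl2)`. -/
abbrev Uq (p : ℕ) := RingQuot (URel p)

def UE (p : ℕ) : Uq p := RingQuot.mkAlgHom ℂ (URel p) fE
def UF (p : ℕ) : Uq p := RingQuot.mkAlgHom ℂ (URel p) fF
def UK (p : ℕ) : Uq p := RingQuot.mkAlgHom ℂ (URel p) fK
def UKinv (p : ℕ) : Uq p := RingQuot.mkAlgHom ℂ (URel p) fKinv

/-- Generators of the braided extension `D`. -/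
inductive DGen | e | phi | k | kinv

abbrev FD := FreeAlgebra ℂ DGen

def fe : FD := FreeAlgebra.ι ℂ DGen.e
def fphi : FD := FreeAlgebra.ι ℂ DGen.phi
def fk : FD := FreeAlgebra.ι ℂ DGen.k
def fkinv : FD := FreeAlgebra.ι ℂ DGen.kinv

/-- Defining relations of `D`. -/
inductive DRel (p : ℕ) : FD → FD → Prop
  | epow : DRel p (fe ^ p) 0
  | phipow : DRel p (fphi ^ p) 0
  | kpow : DRel p (fk ^ (4 * p)) 1
  | kkinv : DRel p (fk * fkinv) 1
  | kinvk : DRel p (fkinv * fk) 1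
  | ke : DRel p (fk * fe * fkinv) (qq p • fe)
  | kphi : DRel p (fk * fphi * fkinv) ((qq p)⁻¹ • fphi)
  | ephi : DRel p (fe * fphi - fphi * fe)
      ((qq p - (qq p)⁻¹)⁻¹ • (fk ^ 2 - fkinv ^ 2))

/-- The braided extension `D` of `U`. -/
abbrev Dq (p : ℕ) := RingQuot (DRel p)

def De (p : ℕ) : Dq p := RingQuot.mkAlgHom ℂ (DRel p) fe
def Dphi (p : ℕ) : Dq p := RingQuot.mkAlgHom ℂ (DRel p) fphi
def Dk (p : ℕ) : Dq p := RingQuot.mkAlgHom ℂ (DRel p) fk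
def Dkinv (p : ℕ) : Dq p := RingQuot.mkAlgHom ℂ (DRel p) fkinv

/-- The `R`-matrix of `D`. -/
def Rmat (p : ℕ) : Dq p ⊗[ℂ] Dq p :=
  ((4 * (p : ℂ))⁻¹) •
    ∑ m ∈ range p, ∑ n ∈ range (4 * p), ∑ j ∈ range (4 * p),
      (((qq p - (qq p)⁻¹) ^ m / qfac p m) *
          (qh p) ^ ((m : ℤ) * ((m : ℤ) - 1) + 2 * (m : ℤ) * ((n : ℤ) - (j : ℤ))
            - (n : ℤ) * (j : ℤ))) •
        ((De p ^ m * Dk p ^ n) ⊗ₜ[ℂ] (Dphi p ^ m * Dk p ^ j))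

/-- `R₂₁ = τ(R)`. -/
def R21 (p : ℕ) : Dq p ⊗[ℂ] Dq p := TensorProduct.comm ℂ (Dq p) (Dq p) (Rmat p)

/-- The monodromy `M = R₂₁ R`. -/
def Mmat (p : ℕ) : Dq p ⊗[ℂ] Dq p := R21 p * Rmat p

/-- The ribbon element `r ∈ D`. -/
def rib (p : ℕ) : Dq p :=
  ((1 - Complex.I) / (2 * (Real.sqrt p : ℂ))) •
    ∑ m ∈ range p, ∑ j ∈ range (2 * p),
      (((qq p - (qq p)⁻¹) ^ m / qfac p m) *
          (qh p) ^ (-(m : ℤ) + 2 * (m : ℤ) * (j : ℤ) + ((j : ℤ) + (p : ℤ) + 1) ^ 2)) •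
        (Dphi p ^ m * De p ^ m * Dk p ^ (2 * j))

/-- The Drinfeld element `u = Σ S(β_i) α_i` for `R = Σ α_i ⊗ β_i`,
depending on a choice of antipode `S`. -/
def drinfeldU (p : ℕ) (S : Dq p →ₗ[ℂ] Dq p) : Dq p :=
  LinearMap.mul' ℂ (Dq p) (TensorProduct.map S LinearMap.id (R21 p))

/-- `Δ` takes the prescribed values on the generators of `U`. -/
def IsDeltaU (p : ℕ) (Δ : Uq p →ₐ[ℂ] Uq p ⊗[ℂ] Uq p) : Prop :=
  Δ (UE p) = 1 ⊗ₜ[ℂ] UE p + UE p ⊗ₜ[ℂ] UK p ∧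
  Δ (UF p) = UKinv p ⊗ₜ[ℂ] UF p + UF p ⊗ₜ[ℂ] 1 ∧
  Δ (UK p) = UK p ⊗ₜ[ℂ] UK p ∧
  Δ (UKinv p) = UKinv p ⊗ₜ[ℂ] UKinv p

/-- `ε` takes the prescribed values on the generators of `U`. -/
def IsCounitU (p : ℕ) (ε : Uq p →ₐ[ℂ] ℂ) : Prop :=
  ε (UE p) = 0 ∧ ε (UF p) = 0 ∧ ε (UK p) = 1 ∧ ε (UKinv p) = 1

/-- `S` is an algebra anti-homomorphism taking the prescribed values on the
generators of `U`. -/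
def IsAntipodeU (p : ℕ) (S : Uq p →ₗ[ℂ] Uq p) : Prop :=
  S 1 = 1 ∧ (∀ x y, S (x * y) = S y * S x) ∧
  S (UE p) = -(UE p * UKinv p) ∧ S (UF p) = -(UK p * UF p) ∧
  S (UK p) = UKinv p ∧ S (UKinv p) = UK p

/-- `Δ` takes the prescribed values on the generators of `D`. -/
def IsDeltaD (p : ℕ) (Δ : Dq p →ₐ[ℂ] Dq p ⊗[ℂ] Dq p) : Prop :=
  Δ (De p) = 1 ⊗ₜ[ℂ] De p + De p ⊗ₜ[ℂ] (Dk p ^ 2) ∧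
  Δ (Dphi p) = (Dkinv p ^ 2) ⊗ₜ[ℂ] Dphi p + Dphi p ⊗ₜ[ℂ] 1 ∧
  Δ (Dk p) = Dk p ⊗ₜ[ℂ] Dk p ∧
  Δ (Dkinv p) = Dkinv p ⊗ₜ[ℂ] Dkinv p

/-- `ε` takes the prescribed values on the generators of `D`. -/
def IsCounitD (p : ℕ) (ε : Dq p →ₐ[ℂ] ℂ) : Prop :=
  ε (De p) = 0 ∧ ε (Dphi p) = 0 ∧ ε (Dk p) = 1 ∧ ε (Dkinv p) = 1

/-- `S` is an algebra anti-homomorphism taking the prescribed values on the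
generators of `D`. -/
def IsAntipodeD (p : ℕ) (S : Dq p →ₗ[ℂ] Dq p) : Prop :=
  S 1 = 1 ∧ (∀ x y, S (x * y) = S y * S x) ∧
  S (De p) = -(De p * Dkinv p ^ 2) ∧ S (Dphi p) = -(Dk p ^ 2 * Dphi p) ∧
  S (Dk p) = Dkinv p ∧ S (Dkinv p) = Dk p

/-- `ι` takes the prescribed values `E ↦ e`, `F ↦ φ`, `K^{±1} ↦ k^{±2}`. -/
def IsIota (p : ℕ) (ι : Uq p →ₐ[ℂ] Dq p) : Prop :=
  ι (UE p) = De p ∧ ι (UF p) = Dphi p ∧ ι (UK p) = Dk p ^ 2 ∧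
  ι (UKinv p) = Dkinv p ^ 2

/-- `μ` takes the prescribed values on the PBW basis of `U`. -/
def IsMu (p : ℕ) (μ : Uq p →ₗ[ℂ] ℂ) : Prop :=
  ∀ m n l : ℕ, m < p → n < p → l < 2 * p →
    μ (UE p ^ m * UF p ^ n * UK p ^ l) =
      if m = p - 1 ∧ n = p - 1 ∧ l = p + 1 then
        -((Real.sqrt (2 / (p : ℝ)) : ℂ)) * (qfac p (p - 1)) ^ 2
      else 0

variable {A : Type*} [Ring A] [Algebra ℂ A]

/-- Coassociativity of a comultiplication. -/
def Coassoc (Δ : A →ₐ[ℂ] A ⊗[ℂ] A) : Prop :=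
  ∀ x, TensorProduct.assoc ℂ A A A
      (TensorProduct.map Δ.toLinearMap LinearMap.id (Δ x)) =
    TensorProduct.map LinearMap.id Δ.toLinearMap (Δ x)

/-- The counit axiom. -/
def CounitAxiom (Δ : A →ₐ[ℂ] A ⊗[ℂ] A) (ε : A →ₐ[ℂ] ℂ) : Prop :=
  (∀ x, TensorProduct.lid ℂ A
      (TensorProduct.map ε.toLinearMap LinearMap.id (Δ x)) = x) ∧
  (∀ x, TensorProduct.rid ℂ A
      (TensorProduct.map LinearMap.id ε.toLinearMap (Δ x)) = x)

/-- The antipode axiom. -/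
def AntipodeAxiom (Δ : A →ₐ[ℂ] A ⊗[ℂ] A) (ε : A →ₐ[ℂ] ℂ)
    (S : A →ₗ[ℂ] A) : Prop :=
  (∀ x, LinearMap.mul' ℂ A (TensorProduct.map S LinearMap.id (Δ x)) = ε x • 1) ∧
  (∀ x, LinearMap.mul' ℂ A (TensorProduct.map LinearMap.id S (Δ x)) = ε x • 1)

/-- `x ↦ x ⊗ 1`. -/
def e1 (p : ℕ) : Dq p →ₗ[ℂ] Dq p ⊗[ℂ] Dq p :=
  (TensorProduct.mk ℂ (Dq p) (Dq p)).flip 1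

/-- `x ↦ 1 ⊗ x`. -/
def e2 (p : ℕ) : Dq p →ₗ[ℂ] Dq p ⊗[ℂ] Dq p :=
  TensorProduct.mk ℂ (Dq p) (Dq p) 1

/-- The balancing element `g = K^{p+1}`. -/
def gU (p : ℕ) : Uq p := UK p ^ (p + 1)

/-- The span of commutators `[U,U]`. -/
def commSpan (p : ℕ) : Submodule ℂ (Uq p) :=
  Submodule.span ℂ {z : Uq p | ∃ x y : Uq p, z = x * y - y * x}

end LogHennings

namespace LogHennings

variable {p : ℕ}

/-- the power of `k` indexed by `ZMod (4p)` -/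
def kap (p : ℕ) (n : ZMod (4 * p)) : Dq p := Dk p ^ n.val

/-- the torus part of the R-matrix, without normalization -/
def Tm (p : ℕ) [NeZero (4 * p)] : Dq p ⊗[ℂ] Dq p :=
  ∑ n : ZMod (4 * p), ∑ j : ZMod (4 * p),
    (ZMod.stdAddChar (-(n * j)) : ℂ) • (kap p n ⊗ₜ[ℂ] kap p j)

lemma Dk_pow_top (p : ℕ) : Dk p ^ (4 * p) = 1 := by
  have h := RingQuot.mkAlgHom_rel ℂ (DRel.kpow (p := p))
  simpa [Dk] using h

lemma Dkinv_Dk (p : ℕ) : Dkinv p * Dk p = 1 := by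
  have h := RingQuot.mkAlgHom_rel ℂ (DRel.kinvk (p := p))
  simpa [Dk, Dkinv] using h

lemma Dk_De (p : ℕ) : Dk p * De p = qq p • (De p * Dk p) := by
  have h := RingQuot.mkAlgHom_rel ℂ (DRel.ke (p := p))
  simp only [map_mul, map_smul] at h
  change Dk p * De p * Dkinv p = qq p • De p at h
  have h2 := congrArg (· * Dk p) h
  simpa [mul_assoc, Dkinv_Dk] using h2

lemma Dk_Dphi (p : ℕ) : Dk p * Dphi p = (qq p)⁻¹ • (Dphi p * Dk p) := by
  have h := RingQuot.mkAlgHom_rel ℂ (DRel.kphi (p := p))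
  simp only [map_mul, map_smul] at h
  change Dk p * Dphi p * Dkinv p = (qq p)⁻¹ • Dphi p at h
  have h2 := congrArg (· * Dk p) h
  simpa [mul_assoc, Dkinv_Dk] using h2

lemma pow_comm_aux {A : Type*} [Ring A] [Algebra ℂ A] {a b : A} {c : ℂ}
    (h : a * b = c • (b * a)) (n m : ℕ) :
    a ^ n * b ^ m = c ^ (n * m) • (b ^ m * a ^ n) := by
  have h1 : ∀ n : ℕ, a ^ n * b = c ^ n • (b * a ^ n) := by
    intro n
    induction n with
    | zero => simp
    | succ n ih =>
      rw [pow_succ, mul_assoc, h, mul_smul_comm, ← mul_assoc, ih, smul_mul_assoc, smul_smul,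
        mul_assoc, pow_succ, mul_comm c]
  induction m with
  | zero => simp
  | succ m ih =>
    rw [pow_succ, ← mul_assoc, ih, smul_mul_assoc, mul_assoc, h1, mul_smul_comm, smul_smul,
      ← pow_add, ← mul_assoc, Nat.mul_succ]

lemma kap_natCast (p n : ℕ) : kap p (n : ZMod (4 * p)) = Dk p ^ n := by
  rw [kap, ZMod.val_natCast]
  exact (pow_eq_pow_mod n (Dk_pow_top p)).symm

lemma kap_add [NeZero (4 * p)] (a b : ZMod (4 * p)) : kap p (a + b) = kap p a * kap p b := by
  rw [← ZMod.natCast_zmod_val a, ← ZMod.natCast_zmod_val b, ← Nat.cast_add, kap_natCast,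
    kap_natCast, kap_natCast, pow_add]

lemma char_int (p : ℕ) [NeZero (4 * p)] (n : ℤ) :
    (ZMod.stdAddChar (n : ZMod (4 * p)) : ℂ) = qh p ^ n := by
  have hp : (p : ℂ) ≠ 0 := by
    have := NeZero.ne (4 * p)
    exact_mod_cast (show p ≠ 0 by omega)
  rw [ZMod.stdAddChar_coe, qh, ← Complex.exp_int_mul]
  congr 1
  push_cast
  field_simp
  ring

lemma qq_eq (p : ℕ) : qq p = qh p ^ 2 := by
  rw [qq, qh, ← Complex.exp_nat_mul]
  congr 1
  rcases eq_or_ne (p : ℂ) 0 with h | h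
  · simp [h]
  · push_cast
    field_simp

lemma kap_De [NeZero (4 * p)] (n : ZMod (4 * p)) (m : ℕ) :
    kap p n * De p ^ m =
      (ZMod.stdAddChar (2 * (m : ZMod (4 * p)) * n) : ℂ) • (De p ^ m * kap p n) := by
  obtain ⟨n, rfl⟩ : ∃ n' : ℕ, (n' : ZMod (4 * p)) = n := ⟨n.val, ZMod.natCast_zmod_val n⟩
  have h := char_int p (2 * m * n)
  push_cast at h
  rw [kap_natCast, pow_comm_aux (Dk_De p), qq_eq, h, ← pow_mul, ← zpow_natCast]
  congr 2
  push_cast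
  ring

lemma kap_Dphi [NeZero (4 * p)] (n : ZMod (4 * p)) (m : ℕ) :
    kap p n * Dphi p ^ m =
      (ZMod.stdAddChar (-(2 * (m : ZMod (4 * p)) * n)) : ℂ) • (Dphi p ^ m * kap p n) := by
  obtain ⟨n, rfl⟩ : ∃ n' : ℕ, (n' : ZMod (4 * p)) = n := ⟨n.val, ZMod.natCast_zmod_val n⟩
  have h := char_int p (-(2 * m * n))
  push_cast at h
  rw [kap_natCast, pow_comm_aux (Dk_Dphi p), qq_eq, h, zpow_neg, inv_pow, ← pow_mul,
    ← zpow_natCast]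
  congr 3
  push_cast
  ring

lemma sum_range_zmod {M : Type*} [AddCommMonoid M] (N : ℕ) [NeZero N] (f : ℕ → M) :
    ∑ n ∈ range N, f n = ∑ n : ZMod N, f n.val := by
  refine Finset.sum_bij' (fun n _ => (n : ZMod N)) (fun n _ => n.val) ?_ ?_ ?_ ?_ ?_
  · intros; simp
  · intro a _; simpa using ZMod.val_lt a
  · intro a ha; simpa using ZMod.val_cast_of_lt (by simpa using ha)
  · intro a _; simp
  · intro a ha; rw [ZMod.val_cast_of_lt (by simpa using ha)]

/-- the coefficients of the nilpotent part -/
def cf (p m : ℕ) : ℂ :=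
  (4 * (p : ℂ))⁻¹ * ((qq p - (qq p)⁻¹) ^ m / qfac p m * qh p ^ ((m : ℤ) * ((m : ℤ) - 1)))

lemma Tm_mul [NeZero (4 * p)] (m : ℕ) : Tm p * ((De p ^ m) ⊗ₜ[ℂ] (Dphi p ^ m)) =
    ∑ n : ZMod (4 * p), ∑ j : ZMod (4 * p),
      (ZMod.stdAddChar (2 * (m : ZMod (4 * p)) * (n - j) - n * j) : ℂ) •
        ((De p ^ m * kap p n) ⊗ₜ[ℂ] (Dphi p ^ m * kap p j)) := by
  rw [Tm, Finset.sum_mul]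
  refine Finset.sum_congr rfl fun n _ => ?_
  rw [Finset.sum_mul]
  refine Finset.sum_congr rfl fun j _ => ?_
  rw [smul_mul_assoc, Algebra.TensorProduct.tmul_mul_tmul, kap_De, kap_Dphi,
    TensorProduct.smul_tmul_smul, smul_smul, ← AddChar.map_add_eq_mul, ← AddChar.map_add_eq_mul]
  congr 2
  ring

lemma Rmat_eq [NeZero (4 * p)] : Rmat p =
    Tm p * ∑ m ∈ range p, cf p m • ((De p ^ m) ⊗ₜ[ℂ] (Dphi p ^ m)) := by
  have hq : qh p ≠ 0 := Complex.exp_ne_zero _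
  rw [Finset.mul_sum, Rmat, Finset.smul_sum]
  refine Finset.sum_congr rfl fun m _ => ?_
  rw [mul_smul_comm, Tm_mul, sum_range_zmod, Finset.smul_sum, Finset.smul_sum]
  refine Finset.sum_congr rfl fun n _ => ?_
  rw [sum_range_zmod, Finset.smul_sum, Finset.smul_sum]
  refine Finset.sum_congr rfl fun j _ => ?_
  rw [smul_smul, smul_smul]
  change _ • ((De p ^ m * kap p n) ⊗ₜ[ℂ] (Dphi p ^ m * kap p j)) = _
  congr 1
  have h := char_int p (2 * m * ((n.val : ℤ) - j.val) - n.val * j.val)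
  push_cast at h
  rw [ZMod.natCast_zmod_val, ZMod.natCast_zmod_val] at h
  rw [h, add_sub_assoc, zpow_add₀ hq, cf]
  push_cast
  ring

lemma comm_mul (x y : Dq p ⊗[ℂ] Dq p) : TensorProduct.comm ℂ (Dq p) (Dq p) (x * y) =
    TensorProduct.comm ℂ (Dq p) (Dq p) x * TensorProduct.comm ℂ (Dq p) (Dq p) y :=
  map_mul (Algebra.TensorProduct.comm ℂ (Dq p) (Dq p)) x y

lemma R21_eq [NeZero (4 * p)] : R21 p =
    Tm p * ∑ m ∈ range p, cf p m • ((Dphi p ^ m) ⊗ₜ[ℂ] (De p ^ m)) := by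
  rw [R21, Rmat_eq, comm_mul]
  congr 1
  · simp only [Tm, map_sum, map_smul, TensorProduct.comm_tmul]
    rw [Finset.sum_comm]
    simp only [mul_comm]
  · simp only [map_sum, map_smul, TensorProduct.comm_tmul]

lemma mul_Tm [NeZero (4 * p)] (m : ℕ) : ((Dphi p ^ m) ⊗ₜ[ℂ] (De p ^ m)) * Tm p =
    Tm p * ((ZMod.stdAddChar (-(4 * (m : ZMod (4 * p)) ^ 2)) : ℂ) •
      ((kap p (-(2 * m)) * Dphi p ^ m) ⊗ₜ[ℂ] (kap p (2 * m) * De p ^ m))) := by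
  rw [Tm, Finset.mul_sum, Finset.sum_mul,
    ← Equiv.sum_comp (Equiv.addRight (-(2 * m : ZMod (4 * p))))]
  refine Finset.sum_congr rfl fun n _ => ?_
  rw [Finset.mul_sum, Finset.sum_mul, ← Equiv.sum_comp (Equiv.addRight (2 * m : ZMod (4 * p)))]
  refine Finset.sum_congr rfl fun j _ => ?_
  simp only [Equiv.coe_addRight]
  rw [mul_smul_comm, smul_mul_assoc, mul_smul_comm, Algebra.TensorProduct.tmul_mul_tmul,
    Algebra.TensorProduct.tmul_mul_tmul, ← mul_assoc, ← mul_assoc, ← kap_add, ← kap_add,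
    kap_De, kap_Dphi, TensorProduct.smul_tmul_smul, smul_smul, smul_smul,
    ← AddChar.map_add_eq_mul, ← AddChar.map_add_eq_mul, ← AddChar.map_add_eq_mul]
  congr 2
  ring

/-- coefficient of `k^N ⊗ k^J` in the square of the torus part -/
def Sc (p : ℕ) [NeZero (4 * p)] (N J : ZMod (4 * p)) : ℂ :=
  ∑ n : ZMod (4 * p), ∑ j : ZMod (4 * p), ZMod.stdAddChar (-(n * j) + -((N - n) * (J - j)))

lemma Tm_sq [NeZero (4 * p)] : Tm p * Tm p =
    ∑ N : ZMod (4 * p), ∑ J : ZMod (4 * p), Sc p N J • (kap p N ⊗ₜ[ℂ] kap p J) := by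
  have h1 : Tm p * Tm p = ∑ n : ZMod (4 * p), ∑ j : ZMod (4 * p), ∑ N : ZMod (4 * p),
      ∑ J : ZMod (4 * p), (ZMod.stdAddChar (-(n * j) + -((N - n) * (J - j))) : ℂ) •
        (kap p N ⊗ₜ[ℂ] kap p J) := by
    conv_lhs => rw [Tm, Finset.sum_mul]
    refine Finset.sum_congr rfl fun n _ => ?_
    rw [Finset.sum_mul]
    refine Finset.sum_congr rfl fun j _ => ?_
    rw [Finset.mul_sum, ← Equiv.sum_comp (Equiv.addRight (-n))]
    refine Finset.sum_congr rfl fun N _ => ?_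
    rw [Finset.mul_sum, ← Equiv.sum_comp (Equiv.addRight (-j))]
    refine Finset.sum_congr rfl fun J _ => ?_
    simp only [Equiv.coe_addRight]
    rw [smul_mul_assoc, mul_smul_comm, smul_smul, Algebra.TensorProduct.tmul_mul_tmul,
      ← kap_add, ← kap_add, ← AddChar.map_add_eq_mul]
    rw [show n + (N + -n) = N by ring, show j + (J + -j) = J by ring,
      ← sub_eq_add_neg N n, ← sub_eq_add_neg J j]
  rw [h1]
  simp only [Sc, Finset.sum_smul]
  calc _ = ∑ n : ZMod (4 * p), ∑ N : ZMod (4 * p), ∑ j : ZMod (4 * p),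
      ∑ J : ZMod (4 * p), (ZMod.stdAddChar (-(n * j) + -((N - n) * (J - j))) : ℂ) •
        (kap p N ⊗ₜ[ℂ] kap p J) := Finset.sum_congr rfl fun n _ => Finset.sum_comm
    _ = _ := by
      rw [Finset.sum_comm]
      refine Finset.sum_congr rfl fun N _ => ?_
      rw [Finset.sum_comm' (t' := univ) (s' := fun _ => univ) (by simp)]
      rw [Finset.sum_comm]
      calc _ = ∑ n : ZMod (4 * p), ∑ J : ZMod (4 * p), ∑ j : ZMod (4 * p),
          (ZMod.stdAddChar (-(n * j) + -((N - n) * (J - j))) : ℂ) •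
          (kap p N ⊗ₜ[ℂ] kap p J) := Finset.sum_congr rfl fun n _ => Finset.sum_comm
        _ = _ := Finset.sum_comm

lemma four_p (p : ℕ) : (4 : ZMod (4 * p)) * p = 0 := by
  have := ZMod.natCast_self (4 * p)
  exact_mod_cast this

lemma char_odd [NeZero (4 * p)] (N : ZMod (4 * p)) (h : Odd N.val) :
    (ZMod.stdAddChar (2 * (p : ZMod (4 * p)) * N) : ℂ) = -1 := by
  have hp : (p : ℂ) ≠ 0 := by
    have := NeZero.ne (4 * p)
    exact_mod_cast (show p ≠ 0 by omega)
  have := char_int p (2 * p * N.val)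
  push_cast at this
  rw [ZMod.natCast_zmod_val] at this
  rw [this, zpow_mul]
  have h2 : qh p ^ (2 * p : ℤ) = -1 := by
    rw [qh, ← Complex.exp_int_mul, ← Complex.exp_pi_mul_I]
    congr 1
    push_cast
    field_simp
  rw [h2, zpow_natCast]
  exact h.neg_one_pow

lemma Sc_swap [NeZero (4 * p)] (N J : ZMod (4 * p)) : Sc p N J = Sc p J N := by
  rw [Sc, Sc, Finset.sum_comm]
  refine Finset.sum_congr rfl fun n _ => Finset.sum_congr rfl fun j _ => ?_
  congr 1
  ring

lemma Sc_odd [NeZero (4 * p)] (N J : ZMod (4 * p)) (h : Odd N.val) : Sc p N J = 0 := by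
  have key : Sc p N J = - Sc p N J := by
    conv_lhs => rw [Sc]
    rw [Sc, ← Finset.sum_neg_distrib]
    refine Finset.sum_congr rfl fun n _ => ?_
    conv_lhs => rw [← Equiv.sum_comp (Equiv.addRight (2 * (p : ZMod (4 * p))))]
    rw [← Finset.sum_neg_distrib]
    refine Finset.sum_congr rfl fun j _ => ?_
    simp only [Equiv.coe_addRight]
    rw [← neg_one_mul (ZMod.stdAddChar _ : ℂ), ← char_odd N h, ← AddChar.map_add_eq_mul]
    congr 1
    linear_combination (-n) * four_p p
  exact self_eq_neg.mp key

end LogHennings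

open LogHennings in
/-- The monodromy `M = R₂₁ R` lies in the image of `ι ⊗ ι : U ⊗ U → D ⊗ D`. -/
theorem monodromy_in_image (p : ℕ) (hp : 2 ≤ p) :
    ∀ ι : Uq p →ₐ[ℂ] Dq p, IsIota p ι →
      Mmat p ∈ LinearMap.range
        (TensorProduct.map ι.toLinearMap ι.toLinearMap) := by
  intro ι ⟨hE, hF, hK, _⟩
  have : NeZero (4 * p) := ⟨by omega⟩
  suffices h : Mmat p ∈ (Algebra.TensorProduct.map ι ι).range by
    obtain ⟨x, hx⟩ := h
    exact ⟨x, hx⟩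
  have ht : ∀ a ∈ ι.range, ∀ b ∈ ι.range,
      a ⊗ₜ[ℂ] b ∈ (Algebra.TensorProduct.map ι ι).range := by
    rintro _ ⟨a, rfl⟩ _ ⟨b, rfl⟩
    exact ⟨a ⊗ₜ b, by simp⟩
  have hmE : De p ∈ ι.range := ⟨_, hE⟩
  have hmF : Dphi p ∈ ι.range := ⟨_, hF⟩
  have hmK : ∀ N : ZMod (4 * p), Even N.val → kap p N ∈ ι.range := by
    intro N ⟨r, hr⟩
    rw [kap, hr, ← two_mul, pow_mul]
    have hk2 : Dk p ^ 2 ∈ ι.range := ⟨_, hK⟩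
    exact pow_mem hk2 r
  have hev : ∀ m : ZMod (4 * p), Even (2 * m).val := by
    intro m
    rw [← ZMod.natCast_zmod_val m, show (2 : ZMod (4 * p)) * (m.val : ZMod (4 * p)) =
      ((2 * m.val : ℕ) : ZMod (4 * p)) by push_cast; rfl, ZMod.val_natCast,
      Nat.even_iff, Nat.mod_mod_of_dvd _ (Dvd.intro (2 * p) (by ring))]
    omega
  have hM : Mmat p = (Tm p * Tm p) * ((∑ m ∈ range p, cf p m •
      ((ZMod.stdAddChar (-(4 * (m : ZMod (4 * p)) ^ 2)) : ℂ) •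
      ((kap p (-(2 * m)) * Dphi p ^ m) ⊗ₜ[ℂ] (kap p (2 * m) * De p ^ m)))) *
      ∑ m ∈ range p, cf p m • ((De p ^ m) ⊗ₜ[ℂ] (Dphi p ^ m))) := by
    have h1 : (∑ m ∈ range p, cf p m • ((Dphi p ^ m) ⊗ₜ[ℂ] (De p ^ m))) * Tm p =
        Tm p * (∑ m ∈ range p, cf p m •
      ((ZMod.stdAddChar (-(4 * (m : ZMod (4 * p)) ^ 2)) : ℂ) •
      ((kap p (-(2 * m)) * Dphi p ^ m) ⊗ₜ[ℂ] (kap p (2 * m) * De p ^ m)))) := by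
      rw [Finset.sum_mul, Finset.mul_sum]
      refine Finset.sum_congr rfl fun m _ => ?_
      rw [smul_mul_assoc, mul_Tm, mul_smul_comm (cf p m)]
    rw [Mmat, R21_eq, Rmat_eq, mul_assoc, ← mul_assoc _ (Tm p), h1]
    simp only [mul_assoc]
  rw [hM]
  refine mul_mem ?_ (mul_mem ?_ ?_)
  · rw [Tm_sq]
    refine sum_mem fun N _ => sum_mem fun J _ => ?_
    rcases Nat.even_or_odd N.val with hN | hN
    · rcases Nat.even_or_odd J.val with hJ | hJ
      · exact Subalgebra.smul_mem _ (ht _ (hmK N hN) _ (hmK J hJ)) _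
      · rw [Sc_swap, Sc_odd J N hJ, zero_smul]
        exact zero_mem _
    · rw [Sc_odd N J hN, zero_smul]
      exact zero_mem _
  · refine sum_mem fun m _ => Subalgebra.smul_mem _ (Subalgebra.smul_mem _ (ht _ ?_ _ ?_) _) _
    · refine mul_mem (hmK _ ?_) (pow_mem hmF m)
      rw [← mul_neg]
      exact hev _
    · exact mul_mem (hmK _ (hev _)) (pow_mem hmE m)
  · exact sum_mem fun m _ => Subalgebra.smul_mem _
      (ht _ (pow_mem hmE m) _ (pow_mem hmF m)) _
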